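/- arXiv:1809.00742 — 2 statements merged into one kernel-verified Lean document; each statement's English description precedes it below -/
import Mathlib

section
/- Let p,m≥2 and let P={321, σ_p, σ_m}, where σ_p is the length-(p+1) permutation p (p+1) 1 2 ... (p−1) and σ_m is the length-(m+1) permutation (m+1) 1 2 ... m. Then for every α∈S_n(P), site 1 of α is active; and if α∈S_n(P) has exactly k active sites and 1≤i≤k, then the number of active sites of α^{↓i} equals: k+1 if i=1 and k<m; m if i=1 and k=m; i if 1<i<p; and p−1 otherwise (i.e., if i>1 and i≥p). In particular, this number depends only on i and k, so P is a regular set of forbidden patterns. -/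
open Equiv

/-- The pattern `σ` (a length-`k` permutation) is contained in the length-`n`
permutation `π` : some subsequence of `π` is order isomorphic to `σ`. -/
def Contains {k n : ℕ} (σ : Equiv.Perm (Fin k)) (π : Equiv.Perm (Fin n)) : Prop :=
  ∃ f : Fin k → Fin n, StrictMono f ∧ ∀ a b : Fin k, σ a < σ b ↔ π (f a) < π (f b)

/-- A set of forbidden patterns, of possibly different lengths. -/
abbrev PatternSet : Type := Set ((k : ℕ) × Equiv.Perm (Fin k))

/-- `π` avoids every pattern of `P`, i.e. `π ∈ S_n(P)`. -/
def AvoidsSet {n : ℕ} (π : Equiv.Perm (Fin n)) (P : PatternSet) : Prop :=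
  ∀ τ ∈ P, ¬ Contains τ.2 π

/-- The (0-indexed) position of the largest entry of `α`. -/
def maxPos {n : ℕ} (α : Equiv.Perm (Fin (n + 1))) : Fin (n + 1) := α⁻¹ (Fin.last n)

/-- `α^→` : transpose the largest entry with the entry immediately to its right
(meaningful when `maxPos α ≠ Fin.last n`, i.e. the largest entry is not last). -/
def moveRight {n : ℕ} (α : Equiv.Perm (Fin (n + 1))) : Equiv.Perm (Fin (n + 1)) :=
  α * Equiv.swap (maxPos α) (maxPos α + 1)

/-- `α^←` : transpose the largest entry with the entry immediately to its left
(meaningful when `maxPos α ≠ 0`, i.e. the largest entry is not first). -/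
def moveLeft {n : ℕ} (α : Equiv.Perm (Fin (n + 1))) : Equiv.Perm (Fin (n + 1)) :=
  α * Equiv.swap (maxPos α) (maxPos α - 1)

/-- `P` is right-justified : moving the largest entry of a `P`-avoiding permutation one
position to the right again yields a `P`-avoiding permutation. -/
def RightJustified (P : PatternSet) : Prop :=
  ∀ (n : ℕ) (α : Equiv.Perm (Fin (n + 1))),
    AvoidsSet α P → maxPos α ≠ Fin.last n → AvoidsSet (moveRight α) P

/-- `α^{↓i}` : insert the new largest entry into site `i` of `α`; the `n+1` sites of a
length-`n` permutation are numbered `1, …, n+1` from right to left, so the new largest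
entry lands at 0-indexed position `n - (i - 1)`. -/
def insertMax {n : ℕ} (α : Equiv.Perm (Fin n)) (i : ℕ) : Equiv.Perm (Fin (n + 1)) :=
  (finSuccEquivLast.permCongr.symm α.optionCongr) *
    (Fin.revPerm * Fin.cycleRange (Fin.rev (⟨n - (i - 1), by omega⟩ : Fin (n + 1))) *
      Fin.revPerm)

/-- Site `i` of `α ∈ S_n(P)` is active (with respect to `P`). -/
def ActiveSite {n : ℕ} (P : PatternSet) (α : Equiv.Perm (Fin n)) (i : ℕ) : Prop :=
  1 ≤ i ∧ i ≤ n + 1 ∧ AvoidsSet (insertMax α i) P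

/-- The number of active sites of `α` with respect to `P`. -/
noncomputable def numActive {n : ℕ} (P : PatternSet) (α : Equiv.Perm (Fin n)) : ℕ :=
  Set.ncard {i : ℕ | ActiveSite P α i}

/-- Delete the largest entry of a length-`(n+1)` permutation. -/
def deleteMax {n : ℕ} (π : Equiv.Perm (Fin (n + 1))) : Equiv.Perm (Fin n) :=
  Equiv.removeNone (finSuccEquivLast.permCongr
    (π * (Fin.revPerm * Fin.cycleRange (Fin.rev (maxPos π)) * Fin.revPerm)⁻¹))

/-- The pattern `321`. -/
def perm321 : Equiv.Perm (Fin 3) := ⟨![2, 1, 0], ![2, 1, 0], by decide, by decide⟩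
/-- The pattern `312`. -/
def perm312 : Equiv.Perm (Fin 3) := ⟨![2, 0, 1], ![1, 2, 0], by decide, by decide⟩
/-- The pattern `231`. -/
def perm231 : Equiv.Perm (Fin 3) := ⟨![1, 2, 0], ![2, 0, 1], by decide, by decide⟩
/-- The pattern `2431`. -/
def perm2431 : Equiv.Perm (Fin 4) := ⟨![1, 3, 2, 0], ![3, 0, 2, 1], by decide, by decide⟩
/-- The pattern `4321`. -/
def perm4321 : Equiv.Perm (Fin 4) := ⟨![3, 2, 1, 0], ![3, 2, 1, 0], by decide, by decide⟩

/-- The pattern `(m+1) 1 2 … m` of length `m + 1`. -/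
def sigmaM (m : ℕ) : Equiv.Perm (Fin (m + 1)) := (finRotate (m + 1))⁻¹

/-- The pattern `p (p+1) 1 2 … (p-1)` of length `p + 1`. -/
def sigmaP (p : ℕ) : Equiv.Perm (Fin (p + 1)) := ((finRotate (p + 1))⁻¹) ^ 2

/-- The largest entry of `α` plays the role of `3` in an occurrence of the pattern
`231` : there are positions `a < b < c` with `α b` largest, `α a < α b` and `α c < α a`. -/
def MaxIn231 {n : ℕ} (α : Equiv.Perm (Fin n)) : Prop :=
  ∃ a b c : Fin n, a < b ∧ b < c ∧ (∀ x, α x ≤ α b) ∧ α a < α b ∧ α c < α a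

/-- The last `p` entries of `α` are in decreasing order. -/
def LastDecreasing {n : ℕ} (α : Equiv.Perm (Fin n)) (p : ℕ) : Prop :=
  ∀ a b : Fin n, n - p ≤ (a : ℕ) → a < b → α b < α a

open Classical in
/-- The color `d(α)` : it is `1` iff the largest entry of `α` plays the role of `3` in an
occurrence of `231` and the length-`p` suffix of `α` is not decreasing; otherwise `0`. -/
noncomputable def colorD {n : ℕ} (p : ℕ) (α : Equiv.Perm (Fin n)) : ℕ :=
  if MaxIn231 α ∧ ¬ LastDecreasing α p then 1 else 0

open Classical in
/-- The color used for `P = {312, 2431}` : it is `1` iff the largest entry of `α` plays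
the role of `3` in an occurrence of `231`; otherwise `0`. -/
noncomputable def colorD2 {n : ℕ} (α : Equiv.Perm (Fin n)) : ℕ :=
  if MaxIn231 α then 1 else 0

lemma permCongr_castSucc {n : ℕ} (α : Equiv.Perm (Fin n)) (x : Fin n) :
    (finSuccEquivLast.permCongr.symm α.optionCongr) x.castSucc = (α x).castSucc := by
  simp [Equiv.permCongr_def]

lemma permCongr_last {n : ℕ} (α : Equiv.Perm (Fin n)) :
    (finSuccEquivLast.permCongr.symm α.optionCongr) (Fin.last n) = Fin.last n := by
  simp [Equiv.permCongr_def]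

lemma insertMax_lt {n : ℕ} (α : Equiv.Perm (Fin n)) (i : ℕ) (hi : 1 ≤ i) (hi' : i ≤ n + 1)
    (x : Fin n) (hx : (x : ℕ) + i < n + 1) :
    insertMax α i x.castSucc = (α x).castSucc := by
  unfold insertMax
  simp only [Equiv.Perm.mul_apply, Fin.revPerm_apply]
  rw [Fin.cycleRange_of_gt, Fin.rev_rev, permCongr_castSucc]
  simp only [Fin.lt_def, Fin.val_rev, Fin.val_castSucc]
  omega

lemma insertMax_ge {n : ℕ} (α : Equiv.Perm (Fin n)) (i : ℕ) (hi : 1 ≤ i) (hi' : i ≤ n + 1)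
    (x : Fin n) (hx : n + 1 ≤ (x : ℕ) + i) :
    insertMax α i x.succ = (α x).castSucc := by
  unfold insertMax
  simp only [Equiv.Perm.mul_apply, Fin.revPerm_apply]
  rw [Fin.cycleRange_of_lt, ← permCongr_castSucc]
  · congr 1
    rw [Fin.rev_succ, Fin.coeSucc_eq_succ, ← Fin.rev_castSucc, Fin.rev_rev]
  simp only [Fin.lt_def, Fin.val_rev, Fin.val_succ]
  omega

lemma insertMax_eq {n : ℕ} (α : Equiv.Perm (Fin n)) (i : ℕ) (hi : 1 ≤ i) (hi' : i ≤ n + 1)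
    (x : Fin (n+1)) (hx : (x : ℕ) + i = n + 1) :
    insertMax α i x = Fin.last n := by
  unfold insertMax
  simp only [Equiv.Perm.mul_apply, Fin.revPerm_apply]
  rw [Fin.cycleRange_of_eq, Fin.rev_zero, permCongr_last]
  congr 1
  ext
  simp only
  omega

lemma sigmaM_lt (m : ℕ) (a b : Fin (m+1)) :
    sigmaM m a < sigmaM m b ↔ (0 < (a:ℕ) ∧ ((b:ℕ) = 0 ∨ (a:ℕ) < b)) := by
  have h : ∀ a : Fin (m+1), ((sigmaM m a : Fin (m+1)) : ℕ) = if (a:ℕ) = 0 then m else a - 1 := by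
    intro a
    obtain ⟨c, rfl⟩ := (finRotate (m+1)).surjective a
    have : sigmaM m (finRotate (m+1) c) = c := by simp [sigmaM]
    rw [this, finRotate_apply]
    rcases Fin.eq_castSucc_or_eq_last c with ⟨d, rfl⟩ | rfl
    · rw [Fin.coeSucc_eq_succ]; simp
    · simp
  rw [Fin.lt_def, h, h]
  split_ifs <;> omega

lemma sigmaP_lt (p : ℕ) (hp : 2 ≤ p) (a b : Fin (p+1)) :
    sigmaP p a < sigmaP p b ↔
      ((2 ≤ (a:ℕ) ∧ ((b:ℕ) < 2 ∨ (a:ℕ) < b)) ∨ ((a:ℕ) < b ∧ (b:ℕ) < 2)) := by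
  have h : ∀ a : Fin (p+1), ((sigmaM p a : Fin (p+1)) : ℕ) = if (a:ℕ) = 0 then p else a - 1 := by
    intro a
    obtain ⟨c, rfl⟩ := (finRotate (p+1)).surjective a
    have : sigmaM p (finRotate (p+1) c) = c := by simp [sigmaM]
    rw [this, finRotate_apply]
    rcases Fin.eq_castSucc_or_eq_last c with ⟨d, rfl⟩ | rfl
    · rw [Fin.coeSucc_eq_succ]; simp
    · simp
  have h2 : ∀ a, sigmaP p a = sigmaM p (sigmaM p a) := by
    intro a; simp [sigmaP, sigmaM, pow_two]
  rw [Fin.lt_def, h2, h2, h, h, h, h]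
  split_ifs <;> omega

/-- Combinatorial criterion for site `i` of `α` to be active. -/
def Crit (p m : ℕ) {n : ℕ} (α : Equiv.Perm (Fin n)) (i : ℕ) : Prop :=
  (∀ a b : Fin n, n + 1 ≤ (a:ℕ) + i → a < b → α a < α b) ∧ i ≤ m ∧
  (∀ c d : Fin n, (c:ℕ) + i < n + 1 → n + 1 + p ≤ (d:ℕ) + 2 + i → α c < α d)

/-- If an occurrence in `insertMax α i` misses the maximum it is an occurrence in `α`. -/
lemma contains_of_miss {n k : ℕ} (σ : Equiv.Perm (Fin k)) (α : Equiv.Perm (Fin n)) (i : ℕ)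
    (hi : 1 ≤ i) (hi' : i ≤ n + 1) (f : Fin k → Fin (n+1)) (hf : StrictMono f)
    (hσ : ∀ a b : Fin k, σ a < σ b ↔ insertMax α i (f a) < insertMax α i (f b))
    (hmiss : ∀ j, (f j : ℕ) + i ≠ n + 1) : Contains σ α := by
  have key : ∀ j, ∃ y : Fin n, insertMax α i (f j) = (α y).castSucc ∧
      (y : ℕ) = if (f j : ℕ) + i < n + 1 then (f j : ℕ) else (f j : ℕ) - 1 := by
    intro j
    have hj := hmiss j
    have hlt := (f j).isLt
    by_cases h : (f j : ℕ) + i < n + 1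
    · refine ⟨⟨f j, by omega⟩, ?_, by simp [h]⟩
      rw [← insertMax_lt α i hi hi' _ h]; rfl
    · refine ⟨⟨f j - 1, by omega⟩, ?_, by simp [h]⟩
      rw [← insertMax_ge α i hi hi' _ (by simp only; omega)]
      congr 1; ext; simp; omega
  choose g hg hg' using key
  refine ⟨g, ?_, ?_⟩
  · intro a b hab
    have := hf hab
    rw [Fin.lt_def] at this ⊢
    have h1 := hmiss a
    have h2 := hmiss b
    rw [hg', hg']
    split_ifs <;> omega
  · intro a b
    rw [hσ, hg, hg, Fin.castSucc_lt_castSucc_iff]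

lemma strictMono_add_le {k N : ℕ} (f : Fin k → Fin N) (hf : StrictMono f) (a b : Fin k)
    (hab : a ≤ b) : (f a : ℕ) + ((b:ℕ) - a) ≤ f b := by
  obtain ⟨d, hd⟩ : ∃ d, (b : ℕ) = a + d := ⟨b - a, by rw [Fin.le_def] at hab; omega⟩
  induction d generalizing b with
  | zero => have : a = b := by ext; omega
            subst this; simp
  | succ d ih =>
    have h1 := ih ⟨a + d, by omega⟩ (by simp [Fin.le_def]) rfl
    have h2 : f ⟨a + d, by omega⟩ < f b := hf (by rw [Fin.lt_def]; simp only; omega)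
    rw [Fin.lt_def] at h2
    simp only at h1
    omega

lemma crit_imp_avoid (p m : ℕ) (hp : 2 ≤ p) (hm : 2 ≤ m) (P : PatternSet)
    (hP : P = {⟨3, perm321⟩, ⟨p + 1, sigmaP p⟩, ⟨m + 1, sigmaM m⟩})
    {n : ℕ} (α : Equiv.Perm (Fin n)) (hα : AvoidsSet α P) (i : ℕ) (hi : 1 ≤ i) (hi' : i ≤ n + 1)
    (hB : Crit p m α i) : AvoidsSet (insertMax α i) P := by
  obtain ⟨hB1, hB2, hB3⟩ := hB
  rintro ⟨k, σ⟩ hτ ⟨f, hf, hσ⟩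
  simp only at f hf hσ
  by_cases hmiss : ∀ j, (f j : ℕ) + i ≠ n + 1
  · exact hα _ hτ (contains_of_miss σ α i hi hi' f hf hσ hmiss)
  push Not at hmiss
  obtain ⟨j, hj⟩ := hmiss
  have hmax : ∀ a, ¬ σ j < σ a := by
    intro a
    rw [hσ, insertMax_eq α i hi hi' _ hj]
    exact not_lt.mpr (Fin.le_last _)
  have after : ∀ a, j < a → ∃ y : Fin n, (y : ℕ) + 1 = f a ∧
      insertMax α i (f a) = (α y).castSucc := by
    intro a ha
    have h := hf ha
    rw [Fin.lt_def] at h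
    refine ⟨⟨f a - 1, by omega⟩, by simp only; omega, ?_⟩
    rw [← insertMax_ge α i hi hi' _ (by simp only; omega)]
    congr 1; ext; simp; omega
  rw [hP] at hτ
  simp only [Set.mem_insert_iff, Set.mem_singleton_iff] at hτ
  rcases hτ with h | h | h
  · cases h
    have hj0 : j = 0 := by
      revert hmax; clear hj after; revert j; decide
    subst hj0
    obtain ⟨y1, h1, h1'⟩ := after 1 (by decide)
    obtain ⟨y2, h2, h2'⟩ := after 2 (by decide)
    have h3 := (hσ 2 1).1 (by decide)
    rw [h1', h2', Fin.castSucc_lt_castSucc_iff] at h3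
    have h4 : f 1 < f 2 := hf (by decide)
    have h5 : f 0 < f 1 := hf (by decide)
    rw [Fin.lt_def] at h4 h5
    exact absurd (hB1 y1 y2 (by omega) (by rw [Fin.lt_def]; omega)) (not_lt.mpr h3.le)
  · cases h
    have hj1 : (j : ℕ) = 1 := by
      have := hmax ⟨1, by omega⟩
      rw [sigmaP_lt p hp] at this
      simp only at this
      omega
    have h1p : 1 < p + 1 := by clear hj1; omega
    have hj1' : j = ⟨1, h1p⟩ := by ext; exact hj1
    subst hj1'
    obtain ⟨y, h1, h1'⟩ := after (Fin.last p) (by rw [Fin.lt_def]; simp only [Fin.val_last]; omega)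
    have h0 : f 0 < f ⟨1, h1p⟩ := hf (by rw [Fin.lt_def]; simp)
    rw [Fin.lt_def] at h0
    have h3 := (hσ (Fin.last p) 0).1 (by rw [sigmaP_lt p hp]; simp; omega)
    have h4 : insertMax α i (f 0) = (α ⟨f 0, by omega⟩).castSucc := by
      rw [← insertMax_lt α i hi hi' _ (by simp only; omega)]; rfl
    rw [h1', h4, Fin.castSucc_lt_castSucc_iff] at h3
    have h5 := strictMono_add_le f hf ⟨1, h1p⟩ (Fin.last p)
      (by rw [Fin.le_def]; simp only [Fin.val_last]; omega)
    simp only [Fin.val_last] at h5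
    exact absurd (hB3 ⟨f 0, by omega⟩ y (by simp only; omega) (by omega)) (not_lt.mpr h3.le)
  · cases h
    have hj1 : (j : ℕ) = 0 := by
      have := hmax 0
      rw [sigmaM_lt m] at this
      simp at this
      simp [this]
    have h5 := strictMono_add_le f hf j (Fin.last m) (Fin.le_last _)
    simp only [Fin.val_last] at h5
    have := (f (Fin.last m)).isLt
    omega

lemma avoid_imp_crit (p m : ℕ) (hp : 2 ≤ p) (hm : 2 ≤ m) (P : PatternSet)
    (hP : P = {⟨3, perm321⟩, ⟨p + 1, sigmaP p⟩, ⟨m + 1, sigmaM m⟩})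
    {n : ℕ} (α : Equiv.Perm (Fin n)) (i : ℕ) (hi : 1 ≤ i) (hi' : i ≤ n + 1)
    (hA : AvoidsSet (insertMax α i) P) : Crit p m α i := by
  have hge := insertMax_ge α i hi hi'
  have hlt := insertMax_lt α i hi hi'
  have heq := insertMax_eq α i hi hi'
  have h1 : ∀ a b : Fin n, n + 1 ≤ (a:ℕ) + i → a < b → α a < α b := by
    intro a b ha hab
    by_contra hcon
    have hba : α b < α a := lt_of_le_of_ne (not_lt.mp hcon)
      (fun h => hab.ne (α.injective h.symm))
    rw [Fin.lt_def] at hab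
    have e0 := heq ⟨n + 1 - i, by omega⟩ (by simp only; omega)
    have e1 := hge a ha
    have e2 := hge b (by omega)
    have l1 : (α a).castSucc < Fin.last n := Fin.castSucc_lt_last _
    have l2 : (α b).castSucc < (α a).castSucc := hba
    have hA' : ¬ Contains perm321 (insertMax α i) := hA ⟨3, perm321⟩ (by simp [hP])
    refine hA' ⟨![⟨n + 1 - i, by omega⟩, a.succ, b.succ], ?_, ?_⟩
    · intro x y hxy
      have g1 : (⟨n + 1 - i, by omega⟩ : Fin (n+1)) < a.succ := by
        rw [Fin.lt_def]; simp only [Fin.val_succ]; omega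
      have g2 : a.succ < b.succ := by
        rw [Fin.lt_def]; simp only [Fin.val_succ]; omega
      have g3 := g1.trans g2
      fin_cases x <;> fin_cases y <;>
        first | exact absurd hxy (by decide) | exact g1 | exact g2 | exact g3
    · intro x y
      have l3 := l2.trans l1
      fin_cases x <;> fin_cases y <;>
        simp [perm321, e0, e1, e2, l1, l2, l3, l1.le, l2.le, l3.le, hba, hba.le, Fin.le_last] <;> decide
  refine ⟨h1, ?_, ?_⟩
  · by_contra hcon
    have hA' : ¬ Contains (sigmaM m) (insertMax α i) := hA ⟨m+1, sigmaM m⟩ (by simp [hP])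
    refine hA' ⟨fun j => ⟨n + 1 - i + j, by omega⟩, ?_, ?_⟩
    · intro x y hxy
      rw [Fin.lt_def] at hxy ⊢; simp only; omega
    have val : ∀ j : Fin (m+1), 0 < (j:ℕ) → ∃ y : Fin n, (y : ℕ) + i = n + j ∧
        insertMax α i ⟨n + 1 - i + j, by omega⟩ = (α y).castSucc := by
      intro j hj
      refine ⟨⟨n + j - i, by omega⟩, by simp only; omega, ?_⟩
      rw [← hge _ (by simp only; omega)]
      congr 1; ext; simp; omega
    have val0 : ∀ j : Fin (m+1), (j:ℕ) = 0 →
        insertMax α i ⟨n + 1 - i + j, by omega⟩ = Fin.last n := by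
      intro j hj
      exact heq _ (by simp only; omega)
    intro a b
    simp only
    rw [sigmaM_lt]
    rcases Nat.eq_zero_or_pos (a:ℕ) with ha | ha
    · rw [val0 a ha]; simp [ha, Fin.le_last]
    obtain ⟨y, hy, hy'⟩ := val a ha
    rcases Nat.eq_zero_or_pos (b:ℕ) with hb | hb
    · rw [val0 b hb, hy']; simp [ha, hb, Fin.castSucc_lt_last]
    obtain ⟨z, hz, hz'⟩ := val b hb
    rw [hy', hz', Fin.castSucc_lt_castSucc_iff]
    constructor
    · rintro ⟨-, h⟩
      exact h1 y z (by omega) (by rw [Fin.lt_def]; omega)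
    · intro h
      refine ⟨ha, Or.inr ?_⟩
      by_contra hab
      rcases Nat.lt_or_ge (z:ℕ) y with hzy | hzy
      · exact absurd (h1 z y (by omega) hzy) (not_lt.mpr h.le)
      · have : y = z := by ext; omega
        subst this; exact lt_irrefl _ h
  · intro c d hc hd
    by_contra hcon
    have hdc' : α d < α c := lt_of_le_of_ne (not_lt.mp hcon)
      (fun h => by have := α.injective h; subst this; omega)
    have hdlt := d.isLt
    obtain ⟨e, he⟩ : ∃ e : Fin n, (e:ℕ) + 2 + i = n + 1 + p := ⟨⟨n + 1 + p - 2 - i, by omega⟩, by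
      simp only; omega⟩
    have hdc : α e < α c := by
      rcases Nat.lt_or_ge (e:ℕ) d with hed | hed
      · exact (h1 e d (by omega) hed).trans hdc'
      · have : d = e := by ext; omega
        rwa [← this]
    have hA' : ¬ Contains (sigmaP p) (insertMax α i) := hA ⟨p+1, sigmaP p⟩ (by simp [hP])
    refine hA'
      ⟨fun j => if (j:ℕ) = 0 then c.castSucc else ⟨n + 1 - i + j - 1, by omega⟩, ?_, ?_⟩
    · intro x y hxy
      rw [Fin.lt_def] at hxy ⊢
      have hy : (y:ℕ) ≠ 0 := by omega
      simp only [hy, if_false]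
      split_ifs
      · simp only [Fin.val_castSucc]; omega
      · simp only; omega
    set F : Fin (p+1) → Fin (n+1) :=
      fun j => if (j:ℕ) = 0 then c.castSucc else ⟨n + 1 - i + j - 1, by omega⟩ with hF
    have val : ∀ j : Fin (p+1), 2 ≤ (j:ℕ) → ∃ y : Fin n, (y : ℕ) + i + 1 = n + j ∧
        insertMax α i (F j) = (α y).castSucc := by
      intro j hj
      refine ⟨⟨n + j - 1 - i, by omega⟩, by simp only; omega, ?_⟩
      rw [← hge _ (by simp only; omega), hF]
      have : (j:ℕ) ≠ 0 := by omega
      simp only [this, if_false]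
      congr 1; ext; simp; omega
    have val1 : ∀ j : Fin (p+1), (j:ℕ) = 1 → insertMax α i (F j) = Fin.last n := by
      intro j hj
      apply heq
      simp only [hF, hj]
      simp; omega
    have val0 : ∀ j : Fin (p+1), (j:ℕ) = 0 → insertMax α i (F j) = (α c).castSucc := by
      intro j hj
      rw [← hlt c hc]
      simp only [hF, hj, if_true]
    have small : ∀ y : Fin n, n + 1 ≤ (y:ℕ) + i → (y:ℕ) ≤ e → α y < α c := by
      intro y hy hye
      rcases Nat.lt_or_ge (y:ℕ) e with h | h
      · exact (h1 y e hy h).trans hdc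
      · have : y = e := by ext; omega
        rwa [this]
    intro a b
    rw [sigmaP_lt p hp]
    have hap := a.isLt
    have hbp := b.isLt
    rcases (by omega : (a:ℕ) = 0 ∨ (a:ℕ) = 1 ∨ 2 ≤ (a:ℕ)) with ha | ha | ha
    · rw [val0 a ha]
      rcases (by omega : (b:ℕ) = 0 ∨ (b:ℕ) = 1 ∨ 2 ≤ (b:ℕ)) with hb | hb | hb
      · rw [val0 b hb]; simp [ha, hb]
      · rw [val1 b hb]; simp [ha, hb, Fin.castSucc_lt_last]
      · obtain ⟨z, hz, hz'⟩ := val b hb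
        rw [hz', Fin.castSucc_lt_castSucc_iff]
        have := small z (by omega) (by omega)
        refine iff_of_false (by omega) (not_lt.mpr this.le)
    · rw [val1 a ha]
      exact iff_of_false (by omega) (not_lt.mpr (Fin.le_last _))
    · obtain ⟨y, hy, hy'⟩ := val a ha
      rw [hy']
      have hsm := small y (by omega) (by omega)
      rcases (by omega : (b:ℕ) = 0 ∨ (b:ℕ) = 1 ∨ 2 ≤ (b:ℕ)) with hb | hb | hb
      · rw [val0 b hb]; exact iff_of_true (by omega) hsm
      · rw [val1 b hb]; exact iff_of_true (by omega) (Fin.castSucc_lt_last _)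
      · obtain ⟨z, hz, hz'⟩ := val b hb
        rw [hz', Fin.castSucc_lt_castSucc_iff]
        constructor
        · intro h
          exact h1 y z (by omega) (by rw [Fin.lt_def]; omega)
        · intro h
          left
          refine ⟨ha, Or.inr ?_⟩
          by_contra hab
          rcases Nat.lt_or_ge (z:ℕ) y with hzy | hzy
          · exact absurd (h1 z y (by omega) hzy) (not_lt.mpr h.le)
          · have : y = z := by ext; omega
            subst this; exact lt_irrefl _ h

lemma crit_one (p m : ℕ) (hp : 2 ≤ p) (hm : 2 ≤ m) {n : ℕ} (α : Equiv.Perm (Fin n)) :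
    Crit p m α 1 := by
  refine ⟨fun a b h _ => ?_, by omega, fun c d _ h => ?_⟩ <;> omega

lemma crit_anti (p m : ℕ) (hp : 2 ≤ p) {n : ℕ} (α : Equiv.Perm (Fin n)) (i j : ℕ) (hij : i ≤ j)
    (h : Crit p m α j) : Crit p m α i := by
  obtain ⟨h1, h2, h3⟩ := h
  refine ⟨fun a b ha hab => h1 a b (by omega) hab, by omega, fun c d hc hd => ?_⟩
  by_cases hcj : (c:ℕ) + j < n + 1
  · exact h3 c d hcj (by omega)
  · exact h1 c d (by omega) (by rw [Fin.lt_def]; omega)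

lemma down_closed_eq (S : Set ℕ) (N : ℕ) (hN : ∀ i ∈ S, 1 ≤ i ∧ i ≤ N)
    (hS : ∀ i j, 1 ≤ i → i ≤ j → j ∈ S → i ∈ S) : S = Set.Icc 1 S.ncard := by
  classical
  obtain ⟨K, hK⟩ : ∃ K, S = Set.Icc 1 K := by
    induction N with
    | zero => exact ⟨0, by ext x; constructor
                           · intro h; have := hN x h; omega
                           · intro h; have := h.1; have := h.2; omega⟩
    | succ N ih =>
      by_cases h : N + 1 ∈ S
      · refine ⟨N+1, Set.ext fun x => ⟨fun hx => hN x hx, fun hx => hS x _ hx.1 hx.2 h⟩⟩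
      · apply ih
        intro i hi
        have := hN i hi
        refine ⟨this.1, ?_⟩
        by_contra hc
        have : i = N + 1 := by omega
        exact h (this ▸ hi)
  have : S.ncard = K := by
    rw [hK, Set.ncard_eq_toFinset_card']; simp
  rw [this]; exact hK

lemma crit_insert_one (p m : ℕ) (hp : 2 ≤ p) {n : ℕ} (α : Equiv.Perm (Fin n)) (j : ℕ)
    (hj : 1 ≤ j) : Crit p m (insertMax α 1) (j+1) ↔ Crit p m α j ∧ j + 1 ≤ m := by
  have hlt : ∀ x : Fin n, insertMax α 1 x.castSucc = (α x).castSucc :=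
    fun x => insertMax_lt α 1 le_rfl (by omega) x (by omega)
  have hlast : insertMax α 1 (Fin.last n) = Fin.last n :=
    insertMax_eq α 1 le_rfl (by omega) _ (by simp)
  constructor
  · rintro ⟨h1, h2, h3⟩
    refine ⟨⟨fun a b ha hab => ?_, by omega, fun c d hc hd => ?_⟩, h2⟩
    · have := h1 a.castSucc b.castSucc (by simp; omega) hab
      rwa [hlt, hlt] at this
    · have := h3 c.castSucc d.castSucc (by simp; omega) (by simp; omega)
      rwa [hlt, hlt] at this
  · rintro ⟨⟨h1, h2, h3⟩, h4⟩
    refine ⟨fun a b ha hab => ?_, h4, fun c d hc hd => ?_⟩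
    · rcases Fin.eq_castSucc_or_eq_last a with ⟨a, rfl⟩ | rfl
      · rcases Fin.eq_castSucc_or_eq_last b with ⟨b, rfl⟩ | rfl
        · rw [hlt, hlt]; exact h1 a b (by simp at ha; omega) hab
        · rw [hlt, hlast]; exact Fin.castSucc_lt_last _
      · exact absurd hab (not_lt.mpr (Fin.le_last _))
    · rcases Fin.eq_castSucc_or_eq_last c with ⟨c, rfl⟩ | rfl
      · rcases Fin.eq_castSucc_or_eq_last d with ⟨d, rfl⟩ | rfl
        · rw [hlt, hlt]; exact h3 c d (by simp at hc; omega) (by simp at hd; omega)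
        · rw [hlt, hlast]; exact Fin.castSucc_lt_last _
      · simp at hc; omega

lemma crit_insert_big (p m : ℕ) (hp : 2 ≤ p) {n : ℕ} (α : Equiv.Perm (Fin n)) (i j : ℕ)
    (hi : 2 ≤ i) (hi' : i ≤ n + 1) (hB : Crit p m α i)
    (hj : 1 ≤ j) (hj' : j ≤ n + 2) :
    Crit p m (insertMax α i) j ↔ j ≤ i ∧ j < p := by
  have hge := insertMax_ge α i (by omega) hi'
  have heq := insertMax_eq α i (by omega) hi'
  obtain ⟨b1, b2, b3⟩ := hB
  constructor
  · rintro ⟨h1, h2, h3⟩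
    have hji : j ≤ i := by
      by_contra hc
      have := h1 ⟨n + 1 - i, by omega⟩ (Fin.last n) (by simp only; omega)
        (by rw [Fin.lt_def]; simp only [Fin.val_last]; omega)
      rw [heq _ (by simp only; omega)] at this
      exact absurd this (not_lt.mpr (Fin.le_last _))
    refine ⟨hji, ?_⟩
    by_contra hc
    have := h3 ⟨n + 1 - i, by omega⟩ (Fin.last n) (by simp only; omega)
      (by simp only [Fin.val_last]; omega)
    rw [heq _ (by simp only; omega)] at this
    exact absurd this (not_lt.mpr (Fin.le_last _))
  · rintro ⟨h1, h2⟩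
    refine ⟨fun a b ha hab => ?_, by omega, fun c d hc hd => by omega⟩
    rw [Fin.lt_def] at hab
    obtain ⟨x, rfl⟩ : ∃ x, a = Fin.succ x := Fin.exists_succ_eq.mpr (by
      rintro rfl; simp at ha; omega) |>.imp fun _ h => h.symm
    obtain ⟨y, rfl⟩ : ∃ y, b = Fin.succ y := Fin.exists_succ_eq.mpr (by
      rintro rfl; simp at hab) |>.imp fun _ h => h.symm
    simp only [Fin.val_succ] at ha hab
    rw [hge x (by omega), hge y (by omega)]
    exact b1 x y (by omega) (by rw [Fin.lt_def]; omega)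

/-- For `p, m ≥ 2` and `P = {321, p(p+1)12…(p-1), (m+1)12…m}` : every
`α ∈ S_n(P)` has its first site active, and if `α ∈ S_n(P)` has exactly `k` active
sites and `1 ≤ i ≤ k`, then the number of active sites of `α^{↓i}` equals `k+1` if
`i = 1` and `k < m`; `m` if `i = 1` and `k = m`; `i` if `1 < i < p`; and `p − 1`
otherwise. In particular this number depends only on `i` and `k`, so `P` is regular. -/
theorem regular_321_sigmaP_sigmaM (p m : ℕ) (hp : 2 ≤ p) (hm : 2 ≤ m) (P : PatternSet)
    (hP : P = {⟨3, perm321⟩, ⟨p + 1, sigmaP p⟩, ⟨m + 1, sigmaM m⟩}) :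
    (∀ (n : ℕ) (α : Equiv.Perm (Fin n)), AvoidsSet α P → ActiveSite P α 1) ∧
    (∀ (n : ℕ) (α : Equiv.Perm (Fin n)) (k i : ℕ), AvoidsSet α P →
      numActive P α = k → 1 ≤ i → i ≤ k →
      numActive P (insertMax α i) =
        if i = 1 ∧ k < m then k + 1
        else if i = 1 ∧ k = m then m
        else if 1 < i ∧ i < p then i
        else p - 1) := by
  have act : ∀ (n : ℕ) (α : Equiv.Perm (Fin n)), AvoidsSet α P → ∀ i,
      ActiveSite P α i ↔ 1 ≤ i ∧ i ≤ n + 1 ∧ Crit p m α i := by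
    intro n α hα i
    constructor
    · rintro ⟨h1, h2, h3⟩
      exact ⟨h1, h2, avoid_imp_crit p m hp hm P hP α i h1 h2 h3⟩
    · rintro ⟨h1, h2, h3⟩
      exact ⟨h1, h2, crit_imp_avoid p m hp hm P hP α hα i h1 h2 h3⟩
  have one : ∀ (n : ℕ) (α : Equiv.Perm (Fin n)), AvoidsSet α P → ActiveSite P α 1 := by
    intro n α hα
    exact (act n α hα 1).2 ⟨le_rfl, by omega, crit_one p m hp hm α⟩
  refine ⟨one, ?_⟩
  intro n α k i hα hk hi hik
  have hS : {i : ℕ | ActiveSite P α i} = Set.Icc 1 k := by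
    rw [← hk]
    refine down_closed_eq _ (n+1) (fun i h => ⟨h.1, h.2.1⟩) ?_
    intro i j h1 hij hj
    have hj' := (act n α hα j).1 hj
    exact (act n α hα i).2 ⟨h1, by omega, crit_anti p m hp α i j hij hj'.2.2⟩
  have hS' : ∀ j, ActiveSite P α j ↔ 1 ≤ j ∧ j ≤ k := by
    intro j
    have : j ∈ {i : ℕ | ActiveSite P α i} ↔ j ∈ Set.Icc 1 k := by rw [hS]
    exact this
  have hiA := (hS' i).2 ⟨hi, hik⟩
  have hiB := (act n α hα i).1 hiA
  have hkB := (act n α hα k).1 ((hS' k).2 ⟨by omega, le_rfl⟩)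
  have hkm : k ≤ m := hkB.2.2.2.1
  have hβ : AvoidsSet (insertMax α i) P := hiA.2.2
  have fin : ∀ K, (∀ j, ActiveSite P (insertMax α i) j ↔ 1 ≤ j ∧ j ≤ K) →
      numActive P (insertMax α i) = K := by
    intro K hK
    have : {j : ℕ | ActiveSite P (insertMax α i) j} = Set.Icc 1 K := Set.ext hK
    rw [numActive, this, Set.ncard_eq_toFinset_card']; simp
  by_cases h1 : i = 1
  · subst h1
    have : numActive P (insertMax α 1) = min (k+1) m := by
      apply fin
      intro j
      rw [act _ _ hβ]
      have hcase : j = 0 ∨ j = 1 ∨ ∃ t, j = t + 1 ∧ 1 ≤ t := by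
        rcases (by omega : j = 0 ∨ j = 1 ∨ 2 ≤ j) with h | h | h
        · exact Or.inl h
        · exact Or.inr (Or.inl h)
        · exact Or.inr (Or.inr ⟨j - 1, by omega, by omega⟩)
      rcases hcase with rfl | rfl | ⟨t, rfl, ht⟩
      · omega
      · exact iff_of_true ⟨le_rfl, by omega, crit_one p m hp hm _⟩ ⟨le_rfl, by omega⟩
      · rw [crit_insert_one p m hp α t ht]
        have h := hS' t
        rw [act n α hα] at h
        constructor
        · rintro ⟨_, h2, h3, h4⟩
          have := h.1 ⟨ht, by omega, h3⟩
          omega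
        · rintro ⟨_, h2⟩
          have := h.2 ⟨ht, by omega⟩
          exact ⟨by omega, by omega, this.2.2, by omega⟩
    rw [this]
    split_ifs <;> omega
  · have : numActive P (insertMax α i) = min i (p-1) := by
      apply fin
      intro j
      rw [act _ _ hβ]
      constructor
      · rintro ⟨a1, a2, a3⟩
        have := (crit_insert_big p m hp α i j (by omega) hiB.2.1 hiB.2.2 a1 a2).1 a3
        omega
      · rintro ⟨a1, a2⟩
        have := hiB.2.1
        exact ⟨a1, by omega, (crit_insert_big p m hp α i j (by omega) hiB.2.1 hiB.2.2 a1
          (by omega)).2 (by omega)⟩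
    rw [this]
    split_ifs <;> omega
end

section
/- Let P={312, 2431, 4321}. For α∈S_n(P), define d(α)=1 if the entry n plays the role of the largest value in an occurrence of the pattern 231 in α AND the last 3 entries of α are not in decreasing order; otherwise d(α)=0. Then: (a) every α∈S_n(P) with n≥1 has either 2 or 3 active sites (and the empty permutation has 1 active site); (b) if α∈S_n(P) has exactly k active sites and color c=d(α), then for 1≤i≤k the number of active sites of α^{↓i} equals 2 if i=1, or if i=2 and (c=1 or k=3), and equals 3 otherwise; (c) d(α^{↓i})=0 if i=1 or (i=k and c=0), and d(α^{↓i})=1 otherwise. -/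
open Equiv

/-- Elementary form of avoidance of `312`, `2431`, `4321`. -/
def Av {n : ℕ} (α : Equiv.Perm (Fin n)) : Prop :=
  (∀ a b c, a < b → b < c → α b < α c → α c < α a → False) ∧
  (∀ a b c d, a < b → b < c → c < d → α d < α a → α a < α c → α c < α b → False) ∧
  (∀ a b c d, a < b → b < c → c < d → α d < α c → α c < α b → α b < α a → False)

theorem contains312 {n : ℕ} (α : Equiv.Perm (Fin n)) :
    Contains perm312 α ↔ ∃ a b c, a < b ∧ b < c ∧ α b < α c ∧ α c < α a := by
  constructor
  · rintro ⟨f, hf, h⟩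
    exact ⟨f 0, f 1, f 2, hf (by decide), hf (by decide), (h 1 2).1 (by decide),
      (h 2 0).1 (by decide)⟩
  · rintro ⟨a, b, c, h1, h2, h3, h4⟩
    refine ⟨![a, b, c], ?_, ?_⟩
    · intro x y hxy
      fin_cases x <;> fin_cases y <;> simp_all <;> order
    · intro x y
      fin_cases x <;> fin_cases y <;> simp [perm312] <;> order

theorem contains2431 {n : ℕ} (α : Equiv.Perm (Fin n)) :
    Contains perm2431 α ↔
      ∃ a b c d, a < b ∧ b < c ∧ c < d ∧ α d < α a ∧ α a < α c ∧ α c < α b := by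
  constructor
  · rintro ⟨f, hf, h⟩
    exact ⟨f 0, f 1, f 2, f 3, hf (by decide), hf (by decide), hf (by decide),
      (h 3 0).1 (by decide), (h 0 2).1 (by decide), (h 2 1).1 (by decide)⟩
  · rintro ⟨a, b, c, d, h1, h2, h3, h4, h5, h6⟩
    refine ⟨![a, b, c, d], ?_, ?_⟩
    · intro x y hxy
      fin_cases x <;> fin_cases y <;> simp_all <;> order
    · intro x y
      fin_cases x <;> fin_cases y <;> simp [perm2431] <;> order

theorem contains4321 {n : ℕ} (α : Equiv.Perm (Fin n)) :
    Contains perm4321 α ↔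
      ∃ a b c d, a < b ∧ b < c ∧ c < d ∧ α d < α c ∧ α c < α b ∧ α b < α a := by
  constructor
  · rintro ⟨f, hf, h⟩
    exact ⟨f 0, f 1, f 2, f 3, hf (by decide), hf (by decide), hf (by decide),
      (h 3 2).1 (by decide), (h 2 1).1 (by decide), (h 1 0).1 (by decide)⟩
  · rintro ⟨a, b, c, d, h1, h2, h3, h4, h5, h6⟩
    refine ⟨![a, b, c, d], ?_, ?_⟩
    · intro x y hxy
      fin_cases x <;> fin_cases y <;> simp_all <;> order
    · intro x y
      fin_cases x <;> fin_cases y <;> simp [perm4321] <;> order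

theorem avoids_iff {n : ℕ} (α : Equiv.Perm (Fin n)) :
    AvoidsSet α {⟨3, perm312⟩, ⟨4, perm2431⟩, ⟨4, perm4321⟩} ↔ Av α := by
  have : AvoidsSet α {⟨3, perm312⟩, ⟨4, perm2431⟩, ⟨4, perm4321⟩} ↔
      ¬ Contains perm312 α ∧ ¬ Contains perm2431 α ∧ ¬ Contains perm4321 α := by
    simp [AvoidsSet]
  rw [this, contains312, contains2431, contains4321]
  simp only [Av, not_exists, not_and]

/-- Position of the new maximum. -/
def ipos (n i : ℕ) : Fin (n + 1) := ⟨n - (i - 1), by omega⟩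

theorem insert_pos {n : ℕ} (α : Equiv.Perm (Fin n)) (i : ℕ) :
    insertMax α i (ipos n i) = Fin.last n := by
  simp [insertMax, ipos, Equiv.Perm.mul_apply, Fin.cycleRange_self]

theorem insert_succAbove {n : ℕ} (α : Equiv.Perm (Fin n)) (i : ℕ) (j : Fin n) :
    insertMax α i ((ipos n i).succAbove j) = (α j).castSucc := by
  have h : Fin.rev ((ipos n i).succAbove j) = (Fin.rev (ipos n i)).succAbove (Fin.rev j) := by
    rw [Fin.rev_succAbove]
  simp only [insertMax, Equiv.Perm.mul_apply, Fin.revPerm_apply, h]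
  have h2 : (⟨n - (i - 1), by omega⟩ : Fin (n + 1)) = ipos n i := rfl
  rw [h2, Fin.cycleRange_succAbove]
  have h3 : j.rev.succ.rev = j.castSucc := by rw [Fin.rev_succ, Fin.rev_rev]
  simp only [h3, Equiv.permCongr_symm, Equiv.permCongr_apply, Equiv.symm_symm,
    finSuccEquivLast_castSucc, Equiv.optionCongr_apply, Option.map_some,
    finSuccEquivLast_symm_some]

theorem Av_insert {n : ℕ} (α : Equiv.Perm (Fin n)) (i : ℕ) (h : Av α) :
    Av (insertMax α i) ↔
      (∀ b c : Fin n, n - (i - 1) ≤ b → b < c → α c < α b) ∧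
      (∀ a c d : Fin n, a < n - (i - 1) → n - (i - 1) ≤ c → c < d → α d < α a → α a < α c →
        False) ∧
      (∀ b c d : Fin n, n - (i - 1) ≤ b → b < c → c < d → α d < α c → α c < α b → False) := by
  have hv : ((ipos n i : Fin (n+1)) : ℕ) = n - (i - 1) := rfl
  have hp := insert_pos α i
  have hs := insert_succAbove α i
  have hlt : ∀ j : Fin n, (ipos n i).succAbove j < ipos n i ↔ (j : ℕ) < n - (i - 1) := by
    intro j
    rw [Fin.succAbove_lt_iff_castSucc_lt, Fin.lt_def, hv]; rfl
  have hgt : ∀ j : Fin n, ipos n i < (ipos n i).succAbove j ↔ n - (i - 1) ≤ (j : ℕ) := by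
    intro j
    rw [Fin.lt_succAbove_iff_le_castSucc, Fin.le_def, hv]; rfl
  have hmono : ∀ j k : Fin n, (ipos n i).succAbove j < (ipos n i).succAbove k ↔ j < k := by
    intro j k
    exact Fin.succAbove_lt_succAbove_iff
  generalize insertMax α i = π at *
  generalize ipos n i = p at *
  have hcl : ∀ x : Fin n, x.castSucc < Fin.last n := fun x => Fin.castSucc_lt_last x
  have hnl : ∀ x : Fin n, ¬ Fin.last n < x.castSucc := fun x => not_lt.2 (hcl x).le
  obtain ⟨A, B, C⟩ := h
  constructor
  · rintro ⟨h1, h2, h3⟩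
    refine ⟨?_, ?_, ?_⟩
    · intro b c hb hbc
      by_contra hcon
      have hlt' : α b < α c :=
        lt_of_le_of_ne (not_lt.1 hcon) (fun e => hbc.ne (α.injective e))
      refine h1 p (p.succAbove b) (p.succAbove c) ((hgt b).2 hb) ((hmono _ _).2 hbc) ?_ ?_
      · rw [hs, hs]; exact hlt'
      · rw [hs, hp]; exact hcl _
    · intro a c d ha hc hcd h4 h5
      refine h2 (p.succAbove a) p (p.succAbove c) (p.succAbove d) ((hlt a).2 ha) ((hgt c).2 hc)
        ((hmono _ _).2 hcd) ?_ ?_ ?_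
      · rw [hs, hs]; exact h4
      · rw [hs, hs]; exact h5
      · rw [hs, hp]; exact hcl _
    · intro b c d hb hbc hcd h4 h5
      refine h3 p (p.succAbove b) (p.succAbove c) (p.succAbove d) ((hgt b).2 hb)
        ((hmono _ _).2 hbc) ((hmono _ _).2 hcd) ?_ ?_ ?_
      · rw [hs, hs]; exact h4
      · rw [hs, hs]; exact h5
      · rw [hs, hp]; exact hcl _
  · rintro ⟨h1, h2, h3⟩
    refine ⟨?_, ?_, ?_⟩
    · intro a b c
      cases a using p.succAboveCases <;> cases b using p.succAboveCases <;>
        cases c using p.succAboveCases <;>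
        simp only [hlt, hgt, hmono, hp, hs, hnl, lt_irrefl, Fin.castSucc_lt_castSucc_iff,
          false_imp_iff, imp_true_iff, hcl, true_imp_iff]
      · intro x y z
        exact absurd z (not_lt.2 (h1 _ _ x y).le)
      · exact A _ _ _
    · intro a b c d
      cases a using p.succAboveCases <;> cases b using p.succAboveCases <;>
        cases c using p.succAboveCases <;> cases d using p.succAboveCases <;>
        simp only [hlt, hgt, hmono, hp, hs, hnl, lt_irrefl, Fin.castSucc_lt_castSucc_iff,
          false_imp_iff, imp_true_iff, hcl, true_imp_iff]
      · intro x y z u v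
        exact h2 _ _ _ x y z u v
      · exact B _ _ _ _
    · intro a b c d
      cases a using p.succAboveCases <;> cases b using p.succAboveCases <;>
        cases c using p.succAboveCases <;> cases d using p.succAboveCases <;>
        simp only [hlt, hgt, hmono, hp, hs, hnl, lt_irrefl, Fin.castSucc_lt_castSucc_iff,
          false_imp_iff, imp_true_iff, hcl, true_imp_iff]
      · intro x y z u v
        exact h3 _ _ _ x y z u v
      · exact C _ _ _ _

/-- The last two entries of `α` are `y, y - 1`. -/
def A3 {n : ℕ} (α : Equiv.Perm (Fin n)) : Prop :=
  ∃ a b : Fin n, (a : ℕ) + 2 = n ∧ (b : ℕ) + 1 = n ∧ (α a : ℕ) = α b + 1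

theorem active_iff {n : ℕ} (α : Equiv.Perm (Fin n)) (i : ℕ) (h : Av α) (hi : 1 ≤ i)
    (hi' : i ≤ n + 1) : Av (insertMax α i) ↔ (i ≤ 2 ∨ i = 3 ∧ A3 α) := by
  rw [Av_insert α i h]
  constructor
  · rintro ⟨h1, h2, h3⟩
    by_cases hi2 : i ≤ 2
    · exact Or.inl hi2
    right
    have hi3 : i = 3 := by
      by_contra hne
      have e1 : (⟨n - 3, by omega⟩ : Fin n) < ⟨n - 2, by omega⟩ := by
        rw [Fin.lt_def]; dsimp; omega
      have e2 : (⟨n - 2, by omega⟩ : Fin n) < ⟨n - 1, by omega⟩ := by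
        rw [Fin.lt_def]; dsimp; omega
      refine h3 ⟨n - 3, by omega⟩ ⟨n - 2, by omega⟩ ⟨n - 1, by omega⟩ (by dsimp; omega) e1 e2
        (h1 _ _ (by dsimp; omega) e2) (h1 _ _ (by dsimp; omega) e1)
    subst hi3
    refine ⟨rfl, ⟨n - 2, by omega⟩, ⟨n - 1, by omega⟩, by dsimp; omega, by dsimp; omega, ?_⟩
    generalize ha : (⟨n - 2, by omega⟩ : Fin n) = a
    generalize hb : (⟨n - 1, by omega⟩ : Fin n) = b
    have ha' : (a : ℕ) = n - 2 := by rw [← ha]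
    have hb' : (b : ℕ) = n - 1 := by rw [← hb]
    have hab : a < b := by rw [Fin.lt_def]; omega
    have hd := h1 a b (by omega) hab
    rw [Fin.lt_def] at hd
    by_contra hne
    obtain ⟨x, hx⟩ := α.surjective ⟨α b + 1, by omega⟩
    have hx' : (α x : ℕ) = α b + 1 := by rw [hx]
    have hxa : (x : ℕ) ≠ a := fun e => by rw [Fin.ext e] at hx'; omega
    have hxb : (x : ℕ) ≠ b := fun e => by rw [Fin.ext e] at hx'; omega
    refine h2 x a b (by omega) (by omega) hab ?_ ?_
    · rw [Fin.lt_def]; omega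
    · rw [Fin.lt_def]; omega
  · rintro (h2 | ⟨rfl, a, b, ha, hb, hab⟩)
    · refine ⟨?_, ?_, ?_⟩ <;> intros <;> omega
    · have key : ∀ x y : Fin n, n - (3 - 1) ≤ (x : ℕ) → x < y → x = a ∧ y = b := by
        intro x y hx hxy
        rw [Fin.lt_def] at hxy
        constructor <;> apply Fin.ext <;> omega
      refine ⟨?_, ?_, ?_⟩
      · intro x y hx hxy
        obtain ⟨rfl, rfl⟩ := key x y hx hxy
        rw [Fin.lt_def]; omega
      · intro z x y hz hx hxy
        obtain ⟨rfl, rfl⟩ := key x y hx hxy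
        simp only [Fin.lt_def]
        omega
      · intros
        omega

open Classical in
theorem numActive_eq {n : ℕ} (α : Equiv.Perm (Fin n)) (h : Av α) :
    numActive {⟨3, perm312⟩, ⟨4, perm2431⟩, ⟨4, perm4321⟩} α =
      if n = 0 then 1 else if A3 α then 3 else 2 := by
  have e : {i : ℕ | ActiveSite {⟨3, perm312⟩, ⟨4, perm2431⟩, ⟨4, perm4321⟩} α i} =
      ((if n = 0 then {1} else if A3 α then {1, 2, 3} else {1, 2} : Finset ℕ) : Set ℕ) := by
    ext i
    simp only [Set.mem_ofPred_eq, ActiveSite, avoids_iff]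
    constructor
    · rintro ⟨h1, h2, h3⟩
      rw [active_iff α i h h1 h2] at h3
      split_ifs with h4 h5
      · simp; omega
      · simp; omega
      · simp [h5] at h3 ⊢; omega
    · intro hi
      have : 1 ≤ i ∧ i ≤ n + 1 ∧ (i ≤ 2 ∨ i = 3 ∧ A3 α) := by
        split_ifs at hi with h4 h5
        · simp at hi; omega
        · obtain ⟨a, b, ha, -⟩ := id h5
          simp at hi
          refine ⟨by omega, by omega, ?_⟩
          simp [h5]; omega
        · simp at hi; omega
      exact ⟨this.1, this.2.1, (active_iff α i h this.1 this.2.1).2 this.2.2⟩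
  rw [numActive, e, Set.ncard_coe_finset]
  split_ifs <;> rfl

/-- `α` is nonempty and ends with its maximum. -/
def LastMax {n : ℕ} (α : Equiv.Perm (Fin n)) : Prop :=
  ∃ b : Fin n, (b : ℕ) + 1 = n ∧ (α b : ℕ) + 1 = n

theorem colorD_ne_zero {n p : ℕ} (α : Equiv.Perm (Fin n)) :
    colorD p α = 1 ↔ (MaxIn231 α ∧ ¬ LastDecreasing α p) := by
  unfold colorD; split_ifs with h <;> simp [h]

theorem colorD_zero {n p : ℕ} (α : Equiv.Perm (Fin n)) :
    colorD p α = 0 ↔ ¬ (MaxIn231 α ∧ ¬ LastDecreasing α p) := by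
  unfold colorD; split_ifs with h <;> simp [h]

/-- The max has at most two entries after it, and they are decreasing. -/
theorem after_max {n : ℕ} (α : Equiv.Perm (Fin n)) (h : Av α) (b : Fin n)
    (hb : (α b : ℕ) + 1 = n) :
    (∀ c d : Fin n, b < c → c < d → α d < α c) ∧ n ≤ (b : ℕ) + 3 := by
  have hmax : ∀ x, x ≠ b → α x < α b := by
    intro x hx
    have : (α x : ℕ) ≠ α b := fun e => hx (α.injective (Fin.ext e))
    rw [Fin.lt_def]; omega
  obtain ⟨A, B, C⟩ := h
  have h1 : ∀ c d : Fin n, b < c → c < d → α d < α c := by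
    intro c d hc hd
    by_contra hcon
    have : α c < α d := lt_of_le_of_ne (not_lt.1 hcon) (fun e => hd.ne (α.injective e))
    exact A b c d hc hd this (hmax d (hc.trans hd).ne')
  refine ⟨h1, ?_⟩
  by_contra hcon
  have e0 : b < (⟨b + 1, by omega⟩ : Fin n) := by rw [Fin.lt_def]; dsimp; omega
  have e1 : (⟨b + 1, by omega⟩ : Fin n) < ⟨b + 2, by omega⟩ := by rw [Fin.lt_def]; dsimp; omega
  have e2 : (⟨b + 2, by omega⟩ : Fin n) < ⟨b + 3, by omega⟩ := by rw [Fin.lt_def]; dsimp; omega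
  exact C b _ _ _ e0 e1 e2 (h1 _ _ (e0.trans e1) e2) (h1 _ _ e0 e1) (hmax _ e0.ne')

theorem is_max {n : ℕ} (α : Equiv.Perm (Fin n)) (b : Fin n) (hm : ∀ x, α x ≤ α b) :
    (α b : ℕ) + 1 = n := by
  obtain ⟨x, hx⟩ := α.surjective ⟨n - 1, by have := b.2; omega⟩
  have := hm x
  rw [Fin.le_def, hx] at this
  dsimp at this; omega

theorem lastDec_of {n : ℕ} (α : Equiv.Perm (Fin n)) (h : Av α) (b : Fin n)
    (hb : (α b : ℕ) + 1 = n) (hb3 : (b : ℕ) + 3 = n) : LastDecreasing α 3 := by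
  intro x y hx hxy
  obtain ⟨h1, -⟩ := after_max α h b hb
  by_cases e : b = x
  · subst e
    have : (α y : ℕ) ≠ α b := fun e => hxy.ne' (α.injective (Fin.ext e))
    rw [Fin.lt_def]; omega
  · have : (b : ℕ) ≠ x := fun e' => e (Fin.ext e')
    exact h1 x y (by rw [Fin.lt_def]; omega) hxy

theorem color_of_A3 {n : ℕ} (α : Equiv.Perm (Fin n)) (h : Av α) (h3 : A3 α) :
    colorD 3 α = 0 := by
  rw [colorD_zero]
  rintro ⟨⟨a, b, c, hab, hbc, hm, h1, h2⟩, hL⟩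
  have hb := is_max α b hm
  obtain ⟨x, y, hx, hy, hxy⟩ := h3
  obtain ⟨h4, h5⟩ := after_max α h b hb
  rw [Fin.lt_def] at *
  by_cases e : (b : ℕ) + 3 = n
  · exact hL (lastDec_of α h b hb e)
  · have e1 : b = x := Fin.ext (by omega)
    have e2 : c = y := Fin.ext (by omega)
    subst e1 e2
    omega

theorem lastMax_iff {n : ℕ} (α : Equiv.Perm (Fin n)) (h : Av α) (hn : n ≠ 0) :
    LastMax α ↔ colorD 3 α = 0 ∧ ¬ A3 α := by
  constructor
  · rintro ⟨b, hb, hm⟩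
    refine ⟨?_, ?_⟩
    · rw [colorD_zero]
      rintro ⟨⟨x, y, z, hxy, hyz, hmy, h1, h2⟩, hL⟩
      have hy := is_max α y hmy
      have : y = b := α.injective (Fin.ext (by omega))
      subst this
      rw [Fin.lt_def] at hyz; omega
    · rintro ⟨x, y, hx, hy, hxy⟩
      have : y = b := Fin.ext (by omega)
      subst this
      omega
  · rintro ⟨hc, h3⟩
    by_contra hL
    obtain ⟨b, hb⟩ := α.surjective ⟨n - 1, by omega⟩
    have hb' : (α b : ℕ) + 1 = n := by rw [hb]; dsimp; omega
    obtain ⟨h4, h5⟩ := after_max α h b hb'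
    have hbl : (b : ℕ) + 1 ≠ n := fun e => hL ⟨b, e, hb'⟩
    have hmax : ∀ x, α x ≤ α b := fun x => by rw [Fin.le_def]; omega
    by_cases e : (b : ℕ) + 2 = n
    · -- ends in `n z`
      set z : Fin n := ⟨b + 1, by omega⟩ with hz
      have hbz : b < z := by rw [Fin.lt_def]; dsimp [z]; omega
      have hzv : (α z : ℕ) ≠ α b := fun e => hbz.ne' (α.injective (Fin.ext e))
      have hzn : (α z : ℕ) + 2 ≠ n := fun e' => h3 ⟨b, z, e, by dsimp [z]; omega, by omega⟩
      obtain ⟨x, hx⟩ := α.surjective ⟨n - 2, by omega⟩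
      have hx' : (α x : ℕ) = n - 2 := by rw [hx]
      have hxb : (x : ℕ) ≠ b := fun e => by rw [Fin.ext e] at hx'; omega
      have hxz : (x : ℕ) ≠ z := fun e => by rw [Fin.ext e] at hx'; omega
      have hzv' : (z : ℕ) = b + 1 := rfl
      rw [colorD_zero] at hc
      apply hc
      have hxb' : x < b := by rw [Fin.lt_def]; omega
      have hlt : α x < α b := by rw [Fin.lt_def]; omega
      refine ⟨⟨x, b, z, hxb', hbz, hmax, hlt, by rw [Fin.lt_def]; omega⟩, ?_⟩
      intro hLD
      have := hLD ⟨b - 1, by omega⟩ b (by dsimp; omega) (by rw [Fin.lt_def] at *; dsimp; omega)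
      exact absurd this (not_lt.2 (hmax _))
    · -- ends in `n y z`
      set y : Fin n := ⟨b + 1, by omega⟩ with hy
      set z : Fin n := ⟨b + 2, by omega⟩ with hz
      have hyv' : (y : ℕ) = b + 1 := rfl
      have hzv' : (z : ℕ) = b + 2 := rfl
      have hby : b < y := by rw [Fin.lt_def]; omega
      have hyz : y < z := by rw [Fin.lt_def]; omega
      have hd := h4 y z hby hyz
      have hne : (α y : ℕ) ≠ α z + 1 := fun e' => h3 ⟨y, z, by omega, by omega, e'⟩
      rw [Fin.lt_def] at hd
      have hyb : (α y : ℕ) ≠ α b := fun e => hby.ne' (α.injective (Fin.ext e))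
      obtain ⟨x, hx⟩ := α.surjective ⟨α z + 1, by omega⟩
      have hx' : (α x : ℕ) = α z + 1 := by rw [hx]
      have hxb : (x : ℕ) ≠ b := fun e => by rw [Fin.ext e] at hx'; omega
      have hxy : (x : ℕ) ≠ y := fun e => by rw [Fin.ext e] at hx'; omega
      have hxz : (x : ℕ) ≠ z := fun e => by rw [Fin.ext e] at hx'; omega
      have hxb' : x < b := by rw [Fin.lt_def]; omega
      exact h.2.1 x b y z hxb' hby hyz (by rw [Fin.lt_def]; omega) (by rw [Fin.lt_def]; omega)
        (by rw [Fin.lt_def]; omega)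

/-- Values of `insertMax` in terms of natural numbers. -/
theorem insert_val_at {n : ℕ} (α : Equiv.Perm (Fin n)) (i : ℕ) (x : Fin (n + 1))
    (hx : (x : ℕ) = n - (i - 1)) : (insertMax α i x : ℕ) = n := by
  have : x = ipos n i := Fin.ext hx
  rw [this, insert_pos]; rfl

theorem insert_val_lt {n : ℕ} (α : Equiv.Perm (Fin n)) (i : ℕ) (x : Fin (n + 1)) (j : Fin n)
    (hx : (x : ℕ) < n - (i - 1)) (hj : (j : ℕ) = x) : (insertMax α i x : ℕ) = α j := by
  have : x = (ipos n i).succAbove j := by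
    rw [Fin.succAbove_of_castSucc_lt]
    · exact Fin.ext hj.symm
    · rw [Fin.lt_def]; simp [ipos]; omega
  rw [this, insert_succAbove]; rfl

theorem insert_val_gt {n : ℕ} (α : Equiv.Perm (Fin n)) (i : ℕ) (x : Fin (n + 1)) (j : Fin n)
    (hx : n - (i - 1) < (x : ℕ)) (hj : (j : ℕ) + 1 = x) : (insertMax α i x : ℕ) = α j := by
  have : x = (ipos n i).succAbove j := by
    rw [Fin.succAbove_of_le_castSucc]
    · exact Fin.ext hj.symm
    · rw [Fin.le_def]; simp [ipos]; omega
  rw [this, insert_succAbove]; rfl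

theorem insert_max_pos {n : ℕ} (α : Equiv.Perm (Fin n)) (i : ℕ) (b : Fin (n + 1))
    (hm : ∀ x, insertMax α i x ≤ insertMax α i b) : (b : ℕ) = n - (i - 1) := by
  have h1 := is_max _ b hm
  have h2 := insert_val_at α i (ipos n i) rfl
  have : b = ipos n i := (insertMax α i).injective (Fin.ext (by omega))
  rw [this]; rfl

theorem ins1 {n : ℕ} (α : Equiv.Perm (Fin n)) :
    ¬ A3 (insertMax α 1) ∧ colorD 3 (insertMax α 1) = 0 := by
  constructor
  · rintro ⟨x, y, hx, hy, hxy⟩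
    rw [insert_val_at α 1 y (by omega)] at hxy
    omega
  · rw [colorD_zero]
    rintro ⟨⟨a, b, c, hab, hbc, hm, -, -⟩, -⟩
    have := insert_max_pos α 1 b hm
    rw [Fin.lt_def] at hbc
    omega

theorem ins2 {n : ℕ} (α : Equiv.Perm (Fin n)) (hn : n ≠ 0) :
    (A3 (insertMax α 2) ↔ LastMax α) ∧ (colorD 3 (insertMax α 2) = 0 ↔ LastMax α) := by
  have hz : ∃ z : Fin n, (z : ℕ) + 1 = n := ⟨⟨n - 1, by omega⟩, by dsimp; omega⟩
  obtain ⟨z, hz⟩ := hz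
  have hP : (insertMax α 2 ⟨n - 1, by omega⟩ : ℕ) = n := insert_val_at α 2 _ (by dsimp)
  have hQ : (insertMax α 2 ⟨n, by omega⟩ : ℕ) = α z :=
    insert_val_gt α 2 _ z (by dsimp; omega) (by dsimp; omega)
  have hLM : LastMax α ↔ (α z : ℕ) + 1 = n := by
    constructor
    · rintro ⟨b, hb, hb'⟩
      have : z = b := Fin.ext (by omega)
      rw [this]; exact hb'
    · intro h; exact ⟨z, hz, h⟩
  rw [hLM]
  constructor
  · constructor
    · rintro ⟨x, y, hx, hy, hxy⟩
      have e1 : x = ⟨n - 1, by omega⟩ := Fin.ext (by dsimp; omega)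
      have e2 : y = ⟨n, by omega⟩ := Fin.ext (by dsimp; omega)
      have e3 := congrArg (fun t => ((insertMax α 2 t : Fin (n + 1)) : ℕ)) e1
      have e4 := congrArg (fun t => ((insertMax α 2 t : Fin (n + 1)) : ℕ)) e2
      omega
    · intro h
      exact ⟨⟨n - 1, by omega⟩, ⟨n, by omega⟩, by dsimp; omega, by dsimp, by omega⟩
  · rw [colorD_zero]
    constructor
    · intro hc
      by_contra hne
      apply hc
      obtain ⟨x, hx⟩ := α.surjective ⟨n - 1, by omega⟩
      have hx' : (α x : ℕ) = n - 1 := by rw [hx]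
      have hxz : (x : ℕ) ≠ z := fun e => by rw [Fin.ext e] at hx'; omega
      have hX : (insertMax α 2 x.castSucc : ℕ) = α x :=
        insert_val_lt α 2 _ x (by simp; omega) (by simp)
      have hxv : ((x.castSucc : Fin (n + 1)) : ℕ) = x := rfl
      refine ⟨⟨x.castSucc, ⟨n - 1, by omega⟩, ⟨n, by omega⟩, ?_, ?_, ?_, ?_, ?_⟩, ?_⟩
      · rw [Fin.lt_def]; dsimp; omega
      · rw [Fin.lt_def]; dsimp; omega
      · intro w; rw [Fin.le_def]; omega
      · rw [Fin.lt_def]; omega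
      · rw [Fin.lt_def]; omega
      · intro hL
        have := hL ⟨n - 2, by omega⟩ ⟨n - 1, by omega⟩ (by dsimp; omega)
          (by rw [Fin.lt_def]; dsimp; omega)
        rw [Fin.lt_def] at this
        omega
    · rintro hm ⟨⟨a, b, c, hab, hbc, hmx, h1, h2⟩, -⟩
      have hb := insert_max_pos α 2 b hmx
      rw [Fin.lt_def] at *
      have e1 : c = ⟨n, by omega⟩ := Fin.ext (by dsimp; omega)
      have e2 : b = ⟨n - 1, by omega⟩ := Fin.ext (by dsimp; omega)
      rw [e1] at h2
      rw [e2] at h1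
      omega

theorem ins3 {n : ℕ} (α : Equiv.Perm (Fin n)) (h3 : A3 α) (hav : Av (insertMax α 3)) :
    A3 (insertMax α 3) ∧ colorD 3 (insertMax α 3) = 0 := by
  have hA : A3 (insertMax α 3) := by
    obtain ⟨x, y, hx, hy, hxy⟩ := h3
    refine ⟨⟨n - 1, by omega⟩, ⟨n, by omega⟩, by dsimp; omega, by dsimp, ?_⟩
    rw [insert_val_gt α 3 ⟨n - 1, by omega⟩ x (by dsimp; omega) (by dsimp; omega),
      insert_val_gt α 3 ⟨n, by omega⟩ y (by dsimp; omega) (by dsimp; omega)]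
    exact hxy
  exact ⟨hA, color_of_A3 _ hav hA⟩

theorem cRegular_312_2431_4321 (P : PatternSet)
    (hP : P = {⟨3, perm312⟩, ⟨4, perm2431⟩, ⟨4, perm4321⟩}) :
    numActive P (1 : Equiv.Perm (Fin 0)) = 1 ∧
    (∀ (n : ℕ) (α : Equiv.Perm (Fin (n + 1))), AvoidsSet α P →
      numActive P α = 2 ∨ numActive P α = 3) ∧
    (∀ (n : ℕ) (α : Equiv.Perm (Fin n)) (k i : ℕ), AvoidsSet α P →
      numActive P α = k → 1 ≤ i → i ≤ k →
      (numActive P (insertMax α i) =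
        if i = 1 ∨ (i = 2 ∧ (colorD 3 α = 1 ∨ k = 3)) then 2 else 3) ∧
      (colorD 3 (insertMax α i) =
        if i = 1 ∨ (i = k ∧ colorD 3 α = 0) then 0 else 1)) := by
  subst hP
  refine ⟨?_, ?_, ?_⟩
  · rw [numActive_eq]
    · rfl
    · refine ⟨?_, ?_, ?_⟩ <;> intro a <;> exact a.elim0
  · intro n α h
    rw [avoids_iff] at h
    rw [numActive_eq α h]
    split_ifs <;> simp_all
  · intro n α k i h hk hi hik
    rw [avoids_iff] at h
    rw [numActive_eq α h] at hk
    have hsite : i ≤ n + 1 ∧ (i ≤ 2 ∨ i = 3 ∧ A3 α) := by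
      split_ifs at hk with h1 h2
      · omega
      · obtain ⟨a, b, ha, -⟩ := id h2
        refine ⟨by omega, ?_⟩
        simp [h2]; omega
      · omega
    have hav := (active_iff α i h hi hsite.1).2 hsite.2
    rw [numActive_eq _ hav]
    simp only [Nat.add_eq_zero_iff, one_ne_zero, and_false, if_false]
    have hc01 : colorD 3 α = 0 ∨ colorD 3 α = 1 := by
      unfold colorD; split_ifs <;> simp
    have hc01' : colorD 3 (insertMax α i) = 0 ∨ colorD 3 (insertMax α i) = 1 := by
      unfold colorD; split_ifs <;> simp
    have hcases : i = 1 ∨ i = 2 ∨ (i = 3 ∧ A3 α) := by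
      rcases hsite.2 with h | h
      · omega
      · exact Or.inr (Or.inr h)
    rcases hcases with rfl | rfl | ⟨rfl, hA⟩
    · obtain ⟨h1, h2⟩ := ins1 α
      simp [h1, h2]
    · have hn : n ≠ 0 := by rintro rfl; simp at hk; omega
      obtain ⟨h1, h2⟩ := ins2 α hn
      have h3 := lastMax_iff α h hn
      rw [if_neg hn] at hk
      by_cases hA : A3 α
      · have hL : ¬ LastMax α := fun hh => (h3.1 hh).2 hA
        have e1 : ¬ A3 (insertMax α 2) := fun hh => hL (h1.1 hh)
        have e2 : colorD 3 (insertMax α 2) = 1 :=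
          hc01'.resolve_left (fun hh => hL (h2.1 hh))
        rw [if_pos hA] at hk
        subst hk
        simp [e1, e2]
      · rw [if_neg hA] at hk
        subst hk
        rcases hc01 with hc | hc
        · have hL : LastMax α := h3.2 ⟨hc, hA⟩
          simp [h1.2 hL, h2.2 hL, hc]
        · have hL : ¬ LastMax α := fun hh => by have := (h3.1 hh).1; omega
          have e1 : ¬ A3 (insertMax α 2) := fun hh => hL (h1.1 hh)
          have e2 : colorD 3 (insertMax α 2) = 1 :=
            hc01'.resolve_left (fun hh => hL (h2.1 hh))
          simp [e1, e2, hc]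
    · obtain ⟨h1, h2⟩ := ins3 α hA hav
      have hc := color_of_A3 α h hA
      have hn : n ≠ 0 := by
        rintro rfl
        obtain ⟨a, -⟩ := hA
        exact a.elim0
      rw [if_neg hn, if_pos hA] at hk
      subst hk
      simp [h1, h2, hc]
end
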